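/- Let 1 ≤ M ≤ N be integers, E ∈ [0,1], and 0 ≤ s < u fixed real numbers with T = u − s. For λ > 0 define PFD(λ) = 1 − ∑_{x=M}^{N} S(M,N,x) · e^{−x(1−E)λs} · (1 − e^{−xλT}) / (xλT). Then, as λ → 0⁺, PFD(λ) / λ^{N−M+1} tends to C(N, M−1) / (N−M+2) · (1/T) · ((u − E·s)^{N−M+2} − ((1−E)·s)^{N−M+2}). -/

import Mathlib

/-- The coefficient `S(M,N,x) = ∑_{k=M}^{x} C(N,x) · C(x,k) · (−1)^{x−k}`. -/
noncomputable def S (M N x : ℕ) : ℝ :=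
  ∑ k ∈ Finset.Icc M x, (N.choose x : ℝ) * (x.choose k : ℝ) * (-1 : ℝ) ^ (x - k)

open Finset Filter Topology

theorem sum_S_mul_pow (M N : ℕ) (y : ℝ) :
    ∑ x ∈ Icc M N, S M N x * y ^ x =
      ∑ k ∈ Icc M N, (N.choose k : ℝ) * y ^ k * (1 - y) ^ (N - k) := by
  simp only [S, sum_mul]
  rw [sum_comm' (t' := Icc M N) (s' := fun k => Icc k N)
    (by intro x k; simp only [mem_Icc]; omega)]
  refine sum_congr rfl fun k hk => ?_
  rw [mem_Icc] at hk
  have h1 : (1 - y) ^ (N - k) =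
      ∑ j ∈ range (N - k + 1), (-y) ^ j * ((N - k).choose j : ℝ) := by
    rw [sub_eq_neg_add, add_pow]
    simp
  have h2 : Icc k N = Ico k (N + 1) := by ext; simp only [mem_Icc, mem_Ico]; omega
  rw [h1, mul_sum, h2, sum_Ico_eq_sum_range, show N + 1 - k = N - k + 1 by omega]
  refine sum_congr rfl fun j hj => ?_
  have h3 : N.choose (k + j) * (k + j).choose k = N.choose k * (N - k).choose j := by
    have := Nat.choose_mul (n := N) (k := k + j) (s := k) (by omega)
    simpa using this
  have h4 : (N.choose (k + j) : ℝ) * ((k + j).choose k : ℝ) =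
      (N.choose k : ℝ) * ((N - k).choose j : ℝ) := by exact_mod_cast h3
  rw [h4, Nat.add_sub_cancel_left, neg_pow y j]
  ring

theorem one_sub_sum_S_mul_pow {M N : ℕ} (hMN : M ≤ N) (y : ℝ) :
    1 - ∑ x ∈ Icc M N, S M N x * y ^ x =
      (1 - y) ^ (N - M + 1) *
        ∑ k ∈ range M, (N.choose k : ℝ) * y ^ k * (1 - y) ^ (M - 1 - k) := by
  have h1 : ∑ k ∈ range (N + 1), (N.choose k : ℝ) * y ^ k * (1 - y) ^ (N - k) = 1 := by
    have h := add_pow y (1 - y) N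
    rw [add_sub_cancel, one_pow] at h
    refine Eq.trans ?_ h.symm
    exact sum_congr rfl fun k _ => by ring
  have h2 : Icc M N = Ico M (N + 1) := by ext; simp only [mem_Icc, mem_Ico]; omega
  rw [← sum_range_add_sum_Ico _ (show M ≤ N + 1 by omega)] at h1
  rw [sum_S_mul_pow, h2, ← eq_sub_of_add_eq h1, mul_sum]
  refine sum_congr rfl fun k hk => ?_
  rw [mem_range] at hk
  rw [show N - k = (N - M + 1) + (M - 1 - k) by omega, pow_add]
  ring

theorem integral_exp_neg_mul {c : ℝ} (hc : c ≠ 0) (a b : ℝ) :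
    ∫ t in a..b, Real.exp (-(c * t)) = Real.exp (-(c * a)) * (1 - Real.exp (-(c * (b - a)))) / c := by
  have h := intervalIntegral.integral_comp_mul_left (a := a) (b := b) Real.exp (neg_ne_zero.2 hc)
  simp only [neg_mul, integral_exp, smul_eq_mul] at h
  rw [h, mul_sub (Real.exp _), ← Real.exp_add, show -(c * a) + -(c * (b - a)) = -(c * b) by ring]
  field_simp
  ring

theorem tendsto_one_sub_exp_neg_mul_div (t : ℝ) :
    Tendsto (fun l : ℝ => (1 - Real.exp (-(l * t))) / l) (𝓝[>] 0) (𝓝 t) := by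
  have h : HasDerivAt (fun l : ℝ => 1 - Real.exp (-(l * t))) t 0 := by
    have := (((hasDerivAt_id (0 : ℝ)).mul_const t).neg.exp).const_sub 1
    simpa using this
  have := h.tendsto_slope_zero_right
  simpa [div_eq_inv_mul] using this

theorem tendsto_integral_one_sub_exp_pow_mul (m : ℕ) {Q : ℝ → ℝ} (hQ : Continuous Q)
    {a b : ℝ} (ha : 0 ≤ a) (hab : a ≤ b) :
    Tendsto (fun l : ℝ => ∫ t in a..b,
        ((1 - Real.exp (-(l * t))) / l) ^ m * Q (Real.exp (-(l * t))))
      (𝓝[>] 0) (𝓝 (∫ t in a..b, t ^ m * Q 1)) := by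
  obtain ⟨C, hC⟩ := (isCompact_Icc (a := (0 : ℝ)) (b := 1)).exists_bound_of_continuousOn
    hQ.continuousOn
  refine intervalIntegral.tendsto_integral_filter_of_dominated_convergence
    (fun t => t ^ m * C) ?_ ?_ ?_ ?_
  · exact Eventually.of_forall fun l => Continuous.aestronglyMeasurable (by fun_prop)
  · filter_upwards [self_mem_nhdsWithin] with l (hl : 0 < l)
    refine Eventually.of_forall fun t ht => ?_
    rw [Set.uIoc_of_le hab] at ht
    have ht0 : 0 ≤ t := ha.trans ht.1.le
    have hlt : 0 ≤ l * t := by positivity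
    have he : Real.exp (-(l * t)) ≤ 1 := Real.exp_le_one_iff.2 (by linarith)
    have h0 : 0 ≤ (1 - Real.exp (-(l * t))) / l := div_nonneg (by linarith) hl.le
    have h1 : (1 - Real.exp (-(l * t))) / l ≤ t := by
      rw [div_le_iff₀ hl]
      linarith [Real.add_one_le_exp (-(l * t))]
    rw [norm_mul, norm_pow, Real.norm_of_nonneg h0]
    exact mul_le_mul (pow_le_pow_left₀ h0 h1 m) (hC _ ⟨(Real.exp_pos _).le, he⟩)
      (norm_nonneg _) (by positivity)
  · exact Continuous.intervalIntegrable (by fun_prop) _ _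
  · refine Eventually.of_forall fun t _ => ?_
    refine ((tendsto_one_sub_exp_neg_mul_div t).pow m).mul ?_
    have h : Continuous fun l : ℝ => Q (Real.exp (-(l * t))) := by fun_prop
    have := (h.tendsto 0).mono_left (nhdsWithin_le_nhds (s := Set.Ioi 0))
    simpa using this

theorem stmt_10 (M N : ℕ) (hM : 1 ≤ M) (hMN : M ≤ N)
    (E s u : ℝ) (hE0 : 0 ≤ E) (hE1 : E ≤ 1) (hs : 0 ≤ s) (hsu : s < u) :
    Filter.Tendsto
      (fun lam : ℝ =>
        (1 - ∑ x ∈ Finset.Icc M N,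
          S M N x * Real.exp (-((x : ℝ) * (1 - E) * lam * s)) *
            (1 - Real.exp (-((x : ℝ) * lam * (u - s)))) / ((x : ℝ) * lam * (u - s)))
          / lam ^ (N - M + 1))
      (nhdsWithin 0 (Set.Ioi 0))
      (nhds ((N.choose (M - 1) : ℝ) / ((N : ℝ) - M + 2) * (1 / (u - s)) *
        ((u - E * s) ^ (N - M + 2) - ((1 - E) * s) ^ (N - M + 2)))) := by
  set Q : ℝ → ℝ := fun y =>
    ∑ k ∈ range M, (N.choose k : ℝ) * y ^ k * (1 - y) ^ (M - 1 - k) with hQ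
  have hT : u - s ≠ 0 := (sub_pos.2 hsu).ne'
  have hQ1 : Q 1 = N.choose (M - 1) := by
    simp only [hQ]
    rw [sum_eq_single_of_mem (M - 1) (mem_range.2 (by omega))]
    · simp
    · intro k hk hne
      rw [mem_range] at hk
      rw [sub_self, zero_pow (by omega), mul_zero]
  have hlim := (tendsto_integral_one_sub_exp_pow_mul (N - M + 1) (Q := Q)
    (by simp only [hQ]; fun_prop) (a := (1 - E) * s) (b := u - E * s)
    (mul_nonneg (by linarith) hs) (by linarith)).const_mul (1 / (u - s))
  have hval : 1 / (u - s) * ∫ t in (1 - E) * s..u - E * s, t ^ (N - M + 1) * Q 1 =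
      (N.choose (M - 1) : ℝ) / ((N : ℝ) - M + 2) * (1 / (u - s)) *
        ((u - E * s) ^ (N - M + 2) - ((1 - E) * s) ^ (N - M + 2)) := by
    rw [intervalIntegral.integral_mul_const, integral_pow, hQ1]
    push_cast [Nat.cast_sub hMN]
    rw [show (N : ℝ) - M + 1 + 1 = N - M + 2 by ring]
    ring
  rw [hval] at hlim
  refine hlim.congr' ?_
  filter_upwards [self_mem_nhdsWithin] with l (hl : 0 < l)
  have hint : ∀ t : ℝ, ((1 - Real.exp (-(l * t))) / l) ^ (N - M + 1) * Q (Real.exp (-(l * t))) =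
      (1 - ∑ x ∈ Icc M N, S M N x * Real.exp (-(x * l * t))) / l ^ (N - M + 1) := by
    intro t
    have h := one_sub_sum_S_mul_pow hMN (Real.exp (-(l * t)))
    rw [div_pow, div_mul_eq_mul_div, ← h]
    simp only [← Real.exp_nat_mul, mul_neg, mul_assoc]
  simp only [hint]
  rw [intervalIntegral.integral_div, intervalIntegral.integral_sub (by simp)
    (Continuous.intervalIntegrable (by fun_prop) _ _), intervalIntegral.integral_finsetSum
    fun x _ => Continuous.intervalIntegrable (by fun_prop) _ _, ← mul_div_assoc]
  congr 1
  rw [intervalIntegral.integral_const, mul_sub, mul_sum, smul_eq_mul,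
    show u - E * s - (1 - E) * s = u - s by ring]
  congr 1
  · field_simp
  refine sum_congr rfl fun x hx => ?_
  rw [mem_Icc] at hx
  have hx0 : (x : ℝ) ≠ 0 := by
    rw [Nat.cast_ne_zero]
    omega
  rw [intervalIntegral.integral_const_mul, integral_exp_neg_mul (mul_ne_zero hx0 hl.ne'),
    show u - E * s - (1 - E) * s = u - s by ring,
    show (x : ℝ) * l * ((1 - E) * s) = x * (1 - E) * l * s by ring]
  field_simp
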